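/- There is no d ≥ 1 and no lattice polytope P ⊂ ℝ^d of dimension d such that #(nP ∩ ℤ^d) = C(n+d, d) + 2·C(n+d−2, d) + 4·C(n+d−3, d) for every integer n ≥ 1; that is, no lattice polytope has h*-polynomial 1 + 2t^2 + 4t^3 (the sequence (1, 0, 2, 4) does not satisfy the degree 3 condition). -/

import Mathlib

open scoped Pointwise

/-- The coercion of an integer point to a real point. -/
def toReal {d : ℕ} (x : Fin d → ℤ) : Fin d → ℝ := fun i => (x i : ℝ)

/-- The number of lattice points in the `n`-th dilation of `P ⊆ ℝ^d`. -/
noncomputable def latticeCount {d : ℕ} (P : Set (Fin d → ℝ)) (n : ℕ) : ℕ :=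
  Set.ncard {x : Fin d → ℤ | toReal x ∈ (n : ℝ) • P}

/-- The finite abelian group `Λ_Δ` attached to a lattice simplex with vertices `v`. -/
def Lambda {d : ℕ} (v : Fin (d + 1) → Fin d → ℤ) : Set (Fin (d + 1) → ℝ) :=
  {r | (∀ j, 0 ≤ r j ∧ r j < 1) ∧
    (∀ i : Fin d, ∃ z : ℤ, ∑ j, r j * (v j i : ℝ) = (z : ℝ)) ∧
    (∃ z : ℤ, ∑ j, r j = (z : ℝ))}

/-- The height `ht(α) = ∑ᵢ αᵢ`. -/
def ht {m : ℕ} (α : Fin m → ℝ) : ℝ := ∑ i, α i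

/-- The support `supp(α) = {i : αᵢ > 0}`. -/
def suppOf {m : ℕ} (α : Fin m → ℝ) : Set (Fin m) := {i | 0 < α i}

/-- Addition on `Λ_Δ`: coordinatewise fractional part of the sum. -/
noncomputable def fadd {m : ℕ} (α β : Fin m → ℝ) : Fin m → ℝ := fun i => Int.fract (α i + β i)

/-- Negation on `Λ_Δ`: coordinatewise fractional part of `1 - αᵢ`. -/
noncomputable def fneg {m : ℕ} (α : Fin m → ℝ) : Fin m → ℝ := fun i => Int.fract (1 - α i)

/-- `P ⊆ ℝ^d` is a lattice polytope of dimension `d`: the convex hull of a finite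
set of lattice points whose affine span is all of `ℝ^d`. -/
def IsFullDimLatticePolytope {d : ℕ} (P : Set (Fin d → ℝ)) : Prop :=
  ∃ V : Finset (Fin d → ℤ),
    P = convexHull ℝ (toReal '' (V : Set (Fin d → ℤ))) ∧ affineSpan ℝ P = ⊤

/-- The nonnegative vectors with coordinate sum `n` in a group `L` of real vectors. -/
def coneLevel {ι : Type*} [Fintype ι] (L : AddSubgroup (ι → ℝ)) (n : ℕ) : Set (ι → ℝ) :=
  {c | c ∈ L ∧ (∀ i, 0 ≤ c i) ∧ ∑ i, c i = n}

/-- The vectors with coordinates in `[0, 1)` and coordinate sum `k` in a group `L` of real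
vectors. -/
def boxLevel {ι : Type*} [Fintype ι] (L : AddSubgroup (ι → ℝ)) (k : ℕ) : Set (ι → ℝ) :=
  {b | b ∈ L ∧ (∀ i, 0 ≤ b i ∧ b i < 1) ∧ ∑ i, b i = k}

/-- The group of real vectors with integer coordinates. -/
def integerVectors (ι : Type*) : AddSubgroup (ι → ℝ) where
  carrier := {c | ∀ i, ∃ z : ℤ, c i = z}
  zero_mem' i := ⟨0, by simp⟩
  add_mem' {a b} ha hb i := by
    obtain ⟨x, hx⟩ := ha i
    obtain ⟨y, hy⟩ := hb i
    exact ⟨x + y, by simp [hx, hy]⟩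
  neg_mem' {a} ha i := by
    obtain ⟨x, hx⟩ := ha i
    exact ⟨-x, by simp [hx]⟩

theorem mem_integerVectors {ι : Type*} {c : ι → ℝ} :
    c ∈ integerVectors ι ↔ ∀ i, ∃ z : ℤ, c i = z := Iff.rfl

theorem fract_mem {ι : Type*} {L : AddSubgroup (ι → ℝ)} (hZ : integerVectors ι ≤ L)
    {c : ι → ℝ} (hc : c ∈ L) :
    (fun i => Int.fract (c i)) ∈ L := by
  have h : (fun i => ((⌊c i⌋ : ℤ) : ℝ)) ∈ L := hZ fun i => ⟨⌊c i⌋, rfl⟩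
  exact L.sub_mem hc h

theorem coe_nat_mem {ι : Type*} {L : AddSubgroup (ι → ℝ)} (hZ : integerVectors ι ≤ L)
    (m : ι → ℕ) : (fun i => (m i : ℝ)) ∈ L :=
  hZ fun i => ⟨m i, by simp⟩

section Box

variable {ι : Type*} [Fintype ι] {L : AddSubgroup (ι → ℝ)}

theorem exists_mem_boxLevel (hsum : ∀ c ∈ L, ∃ z : ℤ, ∑ i, c i = z) {b : ι → ℝ} (hb : b ∈ L)
    (hb' : ∀ i, 0 ≤ b i ∧ b i < 1) : ∃ k, b ∈ boxLevel L k := by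
  obtain ⟨z, hz⟩ := hsum b hb
  have h0 : (0 : ℝ) ≤ z := hz ▸ Finset.sum_nonneg fun i _ => (hb' i).1
  lift z to ℕ using by exact_mod_cast h0
  exact ⟨z, hb, hb', by simpa using hz⟩

/-- The number of ways to write `n` as an ordered sum of `d + 1` natural numbers. -/
theorem natCard_sum_eq {d : ℕ} (hd : Fintype.card ι = d + 1) (n : ℕ) :
    Nat.card {m : ι → ℕ // ∑ i, m i = n} = (n + d).choose d := by
  classical
  rw [← Nat.card_congr (Sym.equivNatSumOfFintype ι n), Nat.card_eq_fintype_card,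
    Sym.card_sym_eq_choose, hd, show d + 1 + n - 1 = n + d by omega]
  exact Nat.choose_symm_add

/-- Every lattice point of the cone is uniquely a box point plus a natural vector. -/
theorem ncard_coneLevel (hZ : integerVectors ι ≤ L) (hsum : ∀ c ∈ L, ∃ z : ℤ, ∑ i, c i = z)
    (hfin : ∀ n, (coneLevel L n).Finite) {d : ℕ} (hd : Fintype.card ι = d + 1) (n : ℕ) :
    (coneLevel L n).ncard =
      ∑ k ∈ Finset.range (n + 1), (boxLevel L k).ncard * (n - k + d).choose d := by
  have hbox : ∀ k, Finite (boxLevel L k) := fun k =>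
    ((hfin k).subset fun b hb => ⟨hb.1, fun i => (hb.2.1 i).1, hb.2.2⟩).to_subtype
  have hsol : ∀ k, Finite {m : ι → ℕ // ∑ i, m i = k} := fun k =>
    Nat.finite_of_card_ne_zero (by rw [natCard_sum_eq hd]; exact (Nat.choose_pos (by omega)).ne')
  let f : (Σ k : Fin (n + 1), boxLevel L k × {m : ι → ℕ // ∑ i, m i = n - k}) → coneLevel L n :=
    fun x => ⟨fun i => x.2.1.1 i + x.2.2.1 i, by
      obtain ⟨k, ⟨b, hb⟩, ⟨m, hm⟩⟩ := x
      refine ⟨L.add_mem hb.1 (coe_nat_mem hZ m), fun i => add_nonneg (hb.2.1 i).1 (by simp), ?_⟩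
      have : (k : ℕ) + (n - k) = n := by omega
      rw [Finset.sum_add_distrib, hb.2.2, ← Nat.cast_sum, hm, ← Nat.cast_add, this]⟩
  have hf : Function.Bijective f := by
    constructor
    · rintro ⟨k, ⟨b, hb⟩, ⟨m, hm⟩⟩ ⟨k', ⟨b', hb'⟩, ⟨m', hm'⟩⟩ h
      have h' : ∀ i, b i + m i = b' i + m' i := fun i => congrFun (congrArg Subtype.val h) i
      have hbb : b = b' := by
        funext i
        have := congrArg Int.fract (h' i)
        rwa [Int.fract_add_natCast, Int.fract_add_natCast, Int.fract_eq_self.2 (hb.2.1 i),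
          Int.fract_eq_self.2 (hb'.2.1 i)] at this
      subst hbb
      have hmm : m = m' := by
        funext i
        exact_mod_cast add_left_cancel (h' i)
      subst hmm
      have hkk : k = k' := by
        have := hb.2.2.symm.trans hb'.2.2
        exact Fin.ext (by exact_mod_cast this)
      subst hkk
      rfl
    · rintro ⟨c, hcL, hc0, hcn⟩
      obtain ⟨k, hk⟩ := exists_mem_boxLevel hsum (fract_mem hZ hcL)
        fun i => ⟨Int.fract_nonneg _, Int.fract_lt_one _⟩
      have hci : ∀ i, Int.fract (c i) + (⌊c i⌋₊ : ℝ) = c i := fun i => by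
        rw [natCast_floor_eq_intCast_floor (hc0 i), Int.fract_add_floor]
      have hsumk : k + ∑ i, ⌊c i⌋₊ = n := by
        have : ∑ i, (Int.fract (c i) + (⌊c i⌋₊ : ℝ)) = n := by simp_rw [hci, hcn]
        rw [Finset.sum_add_distrib, hk.2.2] at this
        exact_mod_cast this
      exact ⟨⟨⟨k, by omega⟩, ⟨_, hk⟩, ⟨fun i => ⌊c i⌋₊, by simp; omega⟩⟩,
        Subtype.ext (funext hci)⟩
  rw [← Nat.card_coe_set_eq, ← Nat.card_congr (Equiv.ofBijective f hf), Nat.card_sigma,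
    Finset.sum_range]
  simp_rw [Nat.card_prod, natCard_sum_eq hd, Nat.card_coe_set_eq]

end Box

/-- A sequence is determined by its binomial transform of degree `d`. -/
theorem eq_of_sum_mul_choose_eq {d : ℕ} {a b : ℕ → ℕ}
    (h : ∀ n, ∑ k ∈ Finset.range (n + 1), a k * (n - k + d).choose d =
      ∑ k ∈ Finset.range (n + 1), b k * (n - k + d).choose d) (n : ℕ) : a n = b n := by
  induction n using Nat.strong_induction_on with
  | _ n ih =>
    have hn := h n
    rw [Finset.sum_range_succ, Finset.sum_range_succ,
      Finset.sum_congr rfl fun k hk => by rw [ih k (Finset.mem_range.1 hk)]] at hn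
    simpa using hn

/-- The coefficients of `1 + 2 t ^ 2 + 4 t ^ 3`. -/
def hCoeff : ℕ → ℕ
  | 0 => 1
  | 2 => 2
  | 3 => 4
  | _ => 0

theorem sum_hCoeff_mul_choose {d : ℕ} (hd : 1 ≤ d) (n : ℕ) :
    ∑ k ∈ Finset.range (n + 1), hCoeff k * (n - k + d).choose d =
      (n + d).choose d + 2 * (n + d - 2).choose d + 4 * (n + d - 3).choose d := by
  have hz : ∀ m k : ℕ, m < k → (m + d - k).choose d = 0 := fun m k h =>
    Nat.choose_eq_zero_of_lt (by omega)
  match n with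
  | 0 => rw [hz 0 2 (by omega), hz 0 3 (by omega)]; simp [hCoeff]
  | 1 => simp [Finset.sum_range_succ, hCoeff, hz]
  | 2 => simp [Finset.sum_range_succ, hCoeff, hz]
  | m + 3 =>
    rw [Finset.sum_range_succ', Finset.sum_range_succ', Finset.sum_range_succ',
      Finset.sum_range_succ', Finset.sum_eq_zero fun k _ => by simp [hCoeff]]
    simp only [hCoeff, zero_mul, zero_add, one_mul, Nat.sub_zero,
      show m + 3 - (0 + 1 + 1 + 1) + d = m + 3 + d - 3 by omega,
      show m + 3 - (0 + 1 + 1) + d = m + 3 + d - 2 by omega]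
    ring

/-- If the box of `L` has a prime number of points, then all of its nonzero points have the
same support. -/
theorem ne_zero_of_prime_card_box {ι : Type*} {L : AddSubgroup (ι → ℝ)}
    (hZ : integerVectors ι ≤ L) {p : ℕ} [Fact p.Prime] (B : Finset (ι → ℝ))
    (hB : ∀ b, b ∈ B ↔ b ∈ L ∧ ∀ i, 0 ≤ b i ∧ b i < 1) (hp : B.card = p)
    {x y : ι → ℝ} (hx : x ∈ B) (hx0 : x ≠ 0) (hy : y ∈ B) {i : ι} (hi : y i ≠ 0) : x i ≠ 0 := by
  let Z := (integerVectors ι).addSubgroupOf L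
  have hmk : ∀ a b : L, (QuotientAddGroup.mk a : L ⧸ Z) = QuotientAddGroup.mk b ↔
      ∀ i, ∃ z : ℤ, b.1 i = a.1 i + z := fun a b => by
    rw [QuotientAddGroup.eq, AddSubgroup.mem_addSubgroupOf, mem_integerVectors]
    refine forall_congr' fun i => exists_congr fun z => ?_
    simp only [AddSubgroup.coe_add, AddSubgroup.coe_neg, Pi.add_apply, Pi.neg_apply]
    constructor <;> intro h <;> linarith
  have hfr : ∀ b ∈ B, ∀ i, Int.fract (b i) = b i := fun b hb i =>
    Int.fract_eq_self.2 (((hB b).1 hb).2 i)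
  let f : B → L ⧸ Z := fun b => QuotientAddGroup.mk ⟨b.1, ((hB b.1).1 b.2).1⟩
  have hf : Function.Bijective f := by
    constructor
    · intro a b h
      refine Subtype.ext (funext fun i => ?_)
      obtain ⟨z, hz⟩ := (hmk _ _).1 h i
      have := congrArg Int.fract hz
      rw [Int.fract_add_intCast] at this
      simp only [hfr _ a.2, hfr _ b.2] at this
      exact this.symm
    · intro q
      obtain ⟨c, rfl⟩ := QuotientAddGroup.mk_surjective q
      refine ⟨⟨fun i => Int.fract (c.1 i), (hB _).2 ⟨fract_mem hZ c.2, fun i =>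
        ⟨Int.fract_nonneg _, Int.fract_lt_one _⟩⟩⟩, (hmk _ _).2 fun i => ⟨⌊c.1 i⌋, ?_⟩⟩
      exact (Int.fract_add_floor _).symm
  have hcard : Nat.card (L ⧸ Z) = p := by
    rw [← Nat.card_congr (Equiv.ofBijective f hf), Nat.card_eq_fintype_card, Fintype.card_coe, hp]
  have h0 : (0 : ι → ℝ) ∈ B := (hB 0).2 ⟨L.zero_mem, fun i => by simp⟩
  have hfx : f ⟨x, hx⟩ ≠ 0 := fun h => by
    have h' : f ⟨x, hx⟩ = f ⟨0, h0⟩ := h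
    exact hx0 (congrArg Subtype.val (hf.1 h'))
  obtain ⟨k, hk⟩ := mem_zmultiples_of_prime_card hcard hfx (g' := f ⟨y, hy⟩)
  have hk' : (QuotientAddGroup.mk (k • (⟨x, ((hB x).1 hx).1⟩ : L)) : L ⧸ Z) =
      QuotientAddGroup.mk ⟨y, ((hB y).1 hy).1⟩ := hk
  obtain ⟨z, hz⟩ := (hmk _ _).1 hk' i
  intro hxi
  apply hi
  have hyz : y i = z := by simpa [hxi] using hz
  rw [← hfr y hy, hyz, Int.fract_intCast]

section PrimeBox

variable {ι : Type*} [Fintype ι] {L : AddSubgroup (ι → ℝ)}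

/-- If the box of `L` has a prime number `p` of points, then the sum of their heights is half of
`p - 1` times the common size of the supports of the nonzero points. -/
theorem exists_two_mul_sum_eq (hZ : integerVectors ι ≤ L) {p : ℕ} [Fact p.Prime]
    (B : Finset (ι → ℝ)) (hB : ∀ b, b ∈ B ↔ b ∈ L ∧ ∀ i, 0 ≤ b i ∧ b i < 1) (hp : B.card = p) :
    ∃ s : ℕ, 2 * ∑ b ∈ B, ∑ i, b i = ((p - 1 : ℕ) * s : ℝ) := by
  classical
  have h0 : (0 : ι → ℝ) ∈ B := (hB 0).2 ⟨L.zero_mem, fun i => by simp⟩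
  obtain ⟨x, hx, hx0⟩ := Finset.exists_mem_ne (hp ▸ (Fact.out : p.Prime).one_lt) (0 : ι → ℝ)
  let s := (Finset.univ.filter fun i => x i ≠ 0).card
  refine ⟨s, ?_⟩
  let g : (ι → ℝ) → ι → ℝ := fun b i => Int.fract (-b i)
  have hgB : ∀ b ∈ B, g b ∈ B := fun b hb =>
    (hB _).2 ⟨fract_mem hZ (L.neg_mem ((hB b).1 hb).1), fun i =>
      ⟨Int.fract_nonneg _, Int.fract_lt_one _⟩⟩
  have hadd : ∀ b ∈ B, ∀ i, b i + g b i = if b i ≠ 0 then 1 else 0 := fun b hb i => by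
    have hfr : Int.fract (b i) = b i := Int.fract_eq_self.2 (((hB b).1 hb).2 i)
    by_cases h : b i = 0
    · simp [g, h]
    · simp only [g, ne_eq, h, not_false_eq_true, if_true]
      rw [Int.fract_neg (by rwa [hfr]), hfr]
      ring
  have hgg : ∀ b ∈ B, g (g b) = b := fun b hb => funext fun i => by
    have h1 := hadd b hb i
    have h2 := hadd _ (hgB b hb) i
    have h3 := ((hB b).1 hb).2 i
    by_cases h : b i = 0
    · simp_all
    · have : g b i ≠ 0 := fun hg => by
        simp only [ne_eq, h, not_false_eq_true, if_true, hg] at h1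
        linarith
      simp only [ne_eq, h, this, not_false_eq_true, if_true] at h1 h2
      linarith
  have hinv : ∑ b ∈ B, ∑ i, g b i = ∑ b ∈ B, ∑ i, b i :=
    Finset.sum_nbij' g g hgB hgB hgg hgg fun _ _ => rfl
  have hs : ∀ b ∈ B.erase 0, ∑ i, (b i + g b i) = s := fun b hb => by
    obtain ⟨hb0, hb⟩ := Finset.mem_erase.1 hb
    rw [Finset.sum_congr rfl fun i _ => hadd b hb i, Finset.sum_boole]
    congr 2
    ext i
    simp only [Finset.mem_filter, Finset.mem_univ, true_and]
    exact ⟨ne_zero_of_prime_card_box hZ B hB hp hx hx0 hb,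
      ne_zero_of_prime_card_box hZ B hB hp hb hb0 hx⟩
  calc 2 * ∑ b ∈ B, ∑ i, b i = ∑ b ∈ B, ∑ i, (b i + g b i) := by
        simp_rw [Finset.sum_add_distrib, hinv, two_mul]
    _ = ∑ b ∈ B.erase 0, ∑ i, (b i + g b i) := by
        rw [← Finset.sum_erase_add B _ h0]
        simp [g]
    _ = ((p - 1 : ℕ) * s : ℝ) := by
        rw [Finset.sum_congr rfl hs, Finset.sum_const, Finset.card_erase_of_mem h0, hp,
          nsmul_eq_mul]

/-- The box points of a lattice simplex are not counted by height by `1 + 2 t ^ 2 + 4 t ^ 3`. -/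
theorem not_forall_ncard_boxLevel (hZ : integerVectors ι ≤ L)
    (hsum : ∀ c ∈ L, ∃ z : ℤ, ∑ i, c i = z) (hfin : ∀ k, (boxLevel L k).Finite) :
    ¬ ∀ k, (boxLevel L k).ncard = hCoeff k := by
  classical
  intro h
  let F : ℕ → Finset (ι → ℝ) := fun k => (hfin k).toFinset
  have hF : ∀ k, (F k).card = hCoeff k := fun k => by
    rw [← h k, Set.ncard_eq_toFinset_card _ (hfin k)]
  have hFm : ∀ k b, b ∈ F k ↔ b ∈ boxLevel L k := fun k b => by simp [F]
  have hdisj : Set.PairwiseDisjoint (Finset.range 4 : Set ℕ) F := fun j _ k _ hjk =>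
    Finset.disjoint_left.2 fun b hb hb' => hjk (by
      have := ((hFm j b).1 hb).2.2.symm.trans ((hFm k b).1 hb').2.2
      exact_mod_cast this)
  let B := (Finset.range 4).biUnion F
  have hB : ∀ b, b ∈ B ↔ b ∈ L ∧ ∀ i, 0 ≤ b i ∧ b i < 1 := fun b => by
    constructor
    · intro hb
      obtain ⟨k, -, hk⟩ := Finset.mem_biUnion.1 hb
      exact ⟨((hFm k b).1 hk).1, ((hFm k b).1 hk).2.1⟩
    · rintro ⟨hbL, hb⟩
      obtain ⟨k, hk⟩ := exists_mem_boxLevel hsum hbL hb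
      refine Finset.mem_biUnion.2 ⟨k, ?_, (hFm k b).2 hk⟩
      by_contra hk4
      have hk0 : hCoeff k = 0 := by
        obtain ⟨m, rfl⟩ := Nat.exists_eq_add_of_le' (not_lt.1 (mt Finset.mem_range.2 hk4))
        simp [hCoeff]
      have := hF k
      rw [hk0, Finset.card_eq_zero] at this
      have hbk := (hFm k b).2 hk
      simp [this] at hbk
  have hcard : B.card = 7 := by
    rw [Finset.card_biUnion hdisj]
    simp [Finset.sum_range_succ, hF, hCoeff]
  have hht : ∑ b ∈ B, ∑ i, b i = 16 := by
    have hk : ∀ k, ∑ b ∈ F k, ∑ i, b i = (hCoeff k * k : ℝ) := fun k => by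
      rw [Finset.sum_congr rfl fun b hb => ((hFm k b).1 hb).2.2, Finset.sum_const, hF,
        nsmul_eq_mul]
    rw [Finset.sum_biUnion hdisj]
    simp only [hk, Finset.sum_range_succ, Finset.sum_range_zero, hCoeff]
    norm_num
  have : Fact (Nat.Prime 7) := ⟨by norm_num⟩
  obtain ⟨s, hs⟩ := exists_two_mul_sum_eq hZ B hB hcard
  rw [hht] at hs
  have : 2 * 16 = (7 - 1) * s := by exact_mod_cast hs
  omega

end PrimeBox

/-- The coefficient vectors `c` with integer sum for which the combination `∑ j, c j • v j` of
lattice points is a lattice point. -/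
def coeffGroup {d : ℕ} {ι : Type*} [Fintype ι] (v : ι → Fin d → ℤ) : AddSubgroup (ι → ℝ) where
  carrier := {c | (∃ z : ℤ, ∑ j, c j = z) ∧ ∃ x : Fin d → ℤ, ∑ j, c j • toReal (v j) = toReal x}
  zero_mem' := ⟨⟨0, by simp⟩, 0, by ext; simp [toReal]⟩
  add_mem' {a b} := by
    rintro ⟨⟨z, hz⟩, x, hx⟩ ⟨⟨w, hw⟩, y, hy⟩
    refine ⟨⟨z + w, by simp [Finset.sum_add_distrib, hz, hw]⟩, x + y, ?_⟩
    simp only [Pi.add_apply, add_smul, Finset.sum_add_distrib, hx, hy]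
    ext
    simp [toReal]
  neg_mem' {a} := by
    rintro ⟨⟨z, hz⟩, x, hx⟩
    refine ⟨⟨-z, by simp [hz]⟩, -x, ?_⟩
    simp only [Pi.neg_apply, neg_smul, Finset.sum_neg_distrib, hx]
    ext
    simp [toReal]

theorem toReal_injective {d : ℕ} : Function.Injective (toReal (d := d)) := fun _ _ h =>
  funext fun i => Int.cast_injective (α := ℝ) (congrFun h i)

theorem integerVectors_le_coeffGroup {d : ℕ} {ι : Type*} [Fintype ι] (v : ι → Fin d → ℤ) :
    integerVectors ι ≤ coeffGroup v := by
  intro c hc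
  choose z hz using hc
  refine ⟨⟨∑ j, z j, by simp [hz]⟩, ∑ j, z j • v j, ?_⟩
  ext i
  simp [toReal, hz]

theorem mem_convexHull_range_iff {E ι : Type*} [AddCommGroup E] [Module ℝ E] [Fintype ι]
    (p : ι → E) (x : E) : x ∈ convexHull ℝ (Set.range p) ↔
      ∃ c : ι → ℝ, (∀ i, 0 ≤ c i) ∧ ∑ i, c i = 1 ∧ ∑ i, c i • p i = x := by
  classical
  constructor
  · intro hx
    have hp : Set.range p = Fintype.linearCombination ℝ p ''
        Set.range fun i => (Pi.single i 1 : ι → ℝ) := by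
      rw [← Set.range_comp]
      congr 1
      ext i
      simp
    rw [hp, ← LinearMap.image_convexHull, convexHull_rangle_single_eq_stdSimplex] at hx
    obtain ⟨c, hc, rfl⟩ := hx
    exact ⟨c, hc.1, hc.2, rfl⟩
  · rintro ⟨c, h0, h1, hx⟩
    exact mem_convexHull_of_exists_fintype c p h0 h1 (fun i => ⟨i, rfl⟩) hx

theorem mem_smul_convexHull_range_iff {E ι : Type*} [AddCommGroup E] [Module ℝ E] [Fintype ι]
    (p : ι → E) {t : ℝ} (ht : 0 < t) (x : E) : x ∈ t • convexHull ℝ (Set.range p) ↔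
      ∃ c : ι → ℝ, (∀ i, 0 ≤ c i) ∧ ∑ i, c i = t ∧ ∑ i, c i • p i = x := by
  rw [Set.mem_smul_set_iff_inv_smul_mem₀ ht.ne', mem_convexHull_range_iff]
  constructor
  · rintro ⟨c, h0, h1, hx⟩
    refine ⟨t • c, fun i => mul_nonneg ht.le (h0 i), ?_, ?_⟩
    · simp [← Finset.mul_sum, h1]
    · simp only [Pi.smul_apply, smul_assoc, ← Finset.smul_sum, hx]
      rw [smul_inv_smul₀ ht.ne']
  · rintro ⟨c, h0, h1, hx⟩
    refine ⟨t⁻¹ • c, fun i => mul_nonneg (inv_nonneg.2 ht.le) (h0 i), ?_, ?_⟩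
    · simp [← Finset.mul_sum, h1, ht.ne']
    · simp only [Pi.smul_apply, smul_assoc, ← Finset.smul_sum, hx]

/-- The lattice points of the dilation of a lattice simplex correspond to their coefficient
vectors with respect to the vertices. -/
theorem exists_bijOn_coneLevel {d : ℕ} {ι : Type*} [Fintype ι] (v : ι → Fin d → ℤ)
    (hv : AffineIndependent ℝ fun i => toReal (v i)) {n : ℕ} (hn : 1 ≤ n) :
    ∃ f : (ι → ℝ) → Fin d → ℝ, Set.BijOn f (coneLevel (coeffGroup v) n)
      (toReal '' {x | toReal x ∈ (n : ℝ) • convexHull ℝ (Set.range fun i => toReal (v i))}) := by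
  have hn' : (0 : ℝ) < n := by exact_mod_cast hn
  refine ⟨fun c => ∑ i, c i • toReal (v i), ?_, ?_, ?_⟩
  · rintro c ⟨⟨-, x, hx⟩, h0, h1⟩
    exact ⟨x, (mem_smul_convexHull_range_iff _ hn' _).2 ⟨c, h0, h1, hx⟩, hx.symm⟩
  · rintro c ⟨-, -, hc⟩ c' ⟨-, -, hc'⟩ h
    have h' : ∑ i, c i • toReal (v i) = ∑ i, c' i • toReal (v i) := h
    funext i
    refine sub_eq_zero.1 (affineIndependent_iff.1 hv Finset.univ (fun i => c i - c' i) ?_ ?_ i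
      (Finset.mem_univ i))
    · rw [Finset.sum_sub_distrib, hc, hc', sub_self]
    · simp_rw [sub_smul]
      rw [Finset.sum_sub_distrib, h', sub_self]
  · rintro _ ⟨x, hx, rfl⟩
    obtain ⟨c, h0, h1, hx'⟩ := (mem_smul_convexHull_range_iff _ hn' _).1 hx
    exact ⟨c, ⟨⟨⟨n, by simpa using h1⟩, x, hx'⟩, h0, h1⟩, hx'⟩

/-- A full-dimensional lattice polytope with exactly `d + 1` lattice points is a simplex. -/
theorem affineIndependent_of_latticeCount_one {d : ℕ} (V : Finset (Fin d → ℤ))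
    (hspan : affineSpan ℝ (convexHull ℝ (toReal '' (V : Set (Fin d → ℤ)))) = ⊤)
    (hcount : latticeCount (convexHull ℝ (toReal '' (V : Set (Fin d → ℤ)))) 1 = d + 1) :
    V.card = d + 1 ∧ AffineIndependent ℝ fun x : V => toReal x.1 := by
  have hrange : Set.range (fun x : V => toReal x.1) = toReal '' (V : Set (Fin d → ℤ)) := by
    ext y
    simp
  have hle : V.card ≤ d + 1 := by
    rw [← hcount, ← Set.ncard_coe_finset]
    refine Set.ncard_le_ncard (fun x hx => ?_) (Set.finite_of_ncard_ne_zero ?_)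
    · simpa using subset_convexHull ℝ _ (Set.mem_image_of_mem toReal hx)
    · exact fun h => d.succ_ne_zero (hcount.symm.trans h)
  rw [affineSpan_convexHull] at hspan
  have hfr : Module.finrank ℝ (vectorSpan ℝ (Set.range fun x : V => toReal x.1)) = d := by
    rw [hrange, AffineSubspace.vectorSpan_eq_top_of_affineSpan_eq_top ℝ _ _ hspan]
    simp
  have hpos : V.card ≠ 0 := by
    intro h
    rw [Finset.card_eq_zero.1 h] at hspan
    simp at hspan
  have hge : d ≤ V.card - 1 :=
    hfr.ge.trans (finrank_vectorSpan_range_le ℝ _ (by rw [Fintype.card_coe]; omega))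
  have hcard : V.card = d + 1 := by omega
  refine ⟨hcard, (affineIndependent_iff_le_finrank_vectorSpan ℝ _ (n := d) ?_).2 hfr.ge⟩
  rw [Fintype.card_coe, hcard]

theorem coneLevel_zero {ι : Type*} [Fintype ι] (L : AddSubgroup (ι → ℝ)) :
    coneLevel L 0 = {0} := by
  ext c
  constructor
  · rintro ⟨-, h0, h1⟩
    rw [Nat.cast_zero, Finset.sum_eq_zero_iff_of_nonneg fun i _ => h0 i] at h1
    exact funext fun i => h1 i (Finset.mem_univ i)
  · rintro rfl
    exact ⟨L.zero_mem, fun _ => le_rfl, by simp⟩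

/-- no lattice polytope has h*-polynomial `1 + 2t² + 4t³`, i.e.
`(1, 0, 2, 4)` does not satisfy the degree 3 condition. -/
theorem stmt15 :
    ¬ ∃ (d : ℕ) (P : Set (Fin d → ℝ)), 1 ≤ d ∧ IsFullDimLatticePolytope P ∧
      ∀ n : ℕ, 1 ≤ n →
        latticeCount P n =
          Nat.choose (n + d) d + 2 * Nat.choose (n + d - 2) d +
            4 * Nat.choose (n + d - 3) d := by
  rintro ⟨d, P, hd, ⟨V, rfl, hspan⟩, hcount⟩
  have hone : latticeCount (convexHull ℝ (toReal '' (V : Set (Fin d → ℤ)))) 1 = d + 1 := by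
    rw [hcount 1 le_rfl, Nat.choose_eq_zero_of_lt (by omega : 1 + d - 2 < d),
      Nat.choose_eq_zero_of_lt (by omega : 1 + d - 3 < d), add_comm 1 d]
    simp
  obtain ⟨hcard, hind⟩ := affineIndependent_of_latticeCount_one V hspan hone
  let v : V → Fin d → ℤ := Subtype.val
  let L := coeffGroup v
  have hrange : toReal '' (V : Set (Fin d → ℤ)) = Set.range fun i => toReal (v i) := by
    ext y
    simp [v]
  have hcone : ∀ n, (coneLevel L n).ncard =
      (n + d).choose d + 2 * (n + d - 2).choose d + 4 * (n + d - 3).choose d := by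
    intro n
    rcases Nat.eq_zero_or_pos n with rfl | hn
    · rw [coneLevel_zero, Set.ncard_singleton, Nat.choose_eq_zero_of_lt (by omega : 0 + d - 2 < d),
        Nat.choose_eq_zero_of_lt (by omega : 0 + d - 3 < d)]
      simp
    · obtain ⟨f, hf⟩ := exists_bijOn_coneLevel v hind hn
      rw [← hcount n hn, latticeCount, hrange, ← Set.ncard_image_of_injective _ toReal_injective,
        ← hf.image_eq, hf.injOn.ncard_image]
  have hfin : ∀ n, (coneLevel L n).Finite := fun n => Set.finite_of_ncard_ne_zero (by
    have : 0 < (n + d).choose d := Nat.choose_pos (by omega)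
    rw [hcone]
    omega)
  have hZ : integerVectors V ≤ L := integerVectors_le_coeffGroup v
  have hsum : ∀ c ∈ L, ∃ z : ℤ, ∑ i, c i = z := fun c hc => hc.1
  refine not_forall_ncard_boxLevel hZ hsum (fun k => (hfin k).subset fun b hb =>
    ⟨hb.1, fun i => (hb.2.1 i).1, hb.2.2⟩) (eq_of_sum_mul_choose_eq (d := d) fun n => ?_)
  rw [← ncard_coneLevel hZ hsum hfin (by rw [Fintype.card_coe, hcard]), hcone,
    sum_hCoeff_mul_choose hd]
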